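/- arXiv:2311.00636 — 7 statements merged into one kernel-verified Lean document; each statement's English description precedes it below -/
import Mathlib

section
/- Let N, R ≥ 1 be natural numbers. For each n ∈ {1,…,N} and r, m ∈ {1,…,R}, let a_{n,m} ∈ ℝ^{P_in} be vectors, b_{n,r,m} ∈ ℝ^{P_out×C} and Λ_{n,r} ∈ ℝ^{C×C} real matrices, and let C₀ ∈ ℝ^{P_out×P_out} be a fixed matrix. Assume (i) b_{n,r,m} = 0 whenever r ≠ m, and (ii) b_{n,m,m} · Λ_{n,m} · b_{n,m,m}ᵀ = C₀ for all n ∈ {1,…,N} and m ∈ {1,…,R}. Then the exact layer-wise GGN equals the K-FAC-expand approximation: Σ_{n=1}^N Σ_{r=1}^R (Σ_{m=1}^R a_{n,m} ⊗ b_{n,r,m}) · Λ_{n,r} · (Σ_{m'=1}^R a_{n,m'} ⊗ b_{n,r,m'})ᵀ = [ (1/(N·R)) Σ_{n=1}^N Σ_{m=1}^R a_{n,m} a_{n,m}ᵀ ] ⊗ [ Σ_{n=1}^N Σ_{m=1}^R Σ_{r=1}^R b_{n,r,m} · Λ_{n,r} · b_{n,r,m}ᵀ ]. -/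
open Matrix Kronecker

/-- Kronecker product of a column vector `a ∈ ℝ^p` (identified with a `p × 1`
column matrix) with an `s × t` matrix `B`, yielding a `(p·s) × t` matrix. -/
def vecKron {p s t : ℕ} (a : Fin p → ℝ) (B : Matrix (Fin s) (Fin t) ℝ) :
    Matrix (Fin p × Fin s) (Fin t) ℝ :=
  Matrix.of fun q k => a q.1 * B q.2 k

/-- The sandwich `(a ⊗ B) M (a ⊗ B)ᵀ` factors as `(a aᵀ) ⊗ (B M Bᵀ)`. -/
theorem vecKron_mul_mul_transpose {p s t : ℕ} (a : Fin p → ℝ) (B : Matrix (Fin s) (Fin t) ℝ)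
    (M : Matrix (Fin t) (Fin t) ℝ) :
    vecKron a B * M * (vecKron a B)ᵀ = vecMulVec a a ⊗ₖ (B * M * Bᵀ) := by
  ext ⟨i, j⟩ ⟨k, l⟩
  simp only [vecKron, mul_apply, transpose_apply, of_apply, kroneckerMap_apply, vecMulVec_apply,
    Finset.mul_sum, Finset.sum_mul]
  exact Finset.sum_congr rfl fun _ _ => Finset.sum_congr rfl fun _ _ => by ring

theorem vecKron_zero {p s t : ℕ} (a : Fin p → ℝ) :
    vecKron a (0 : Matrix (Fin s) (Fin t) ℝ) = 0 := by
  ext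
  simp [vecKron]

/-- Sufficient condition for exactness of K-FAC-expand in the expand setting. -/
theorem kfac_expand_exact_of_b_diag_const
    (N R Pin Pout C : ℕ) (hN : 1 ≤ N) (hR : 1 ≤ R)
    (a : Fin N → Fin R → (Fin Pin → ℝ))
    (b : Fin N → Fin R → Fin R → Matrix (Fin Pout) (Fin C) ℝ)
    (Λ : Fin N → Fin R → Matrix (Fin C) (Fin C) ℝ)
    (C₀ : Matrix (Fin Pout) (Fin Pout) ℝ)
    (hb : ∀ n r m, r ≠ m → b n r m = 0)
    (hC : ∀ n m, b n m m * Λ n m * (b n m m)ᵀ = C₀) :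
    ∑ n, ∑ r, (∑ m, vecKron (a n m) (b n r m)) * Λ n r *
        (∑ m', vecKron (a n m') (b n r m'))ᵀ
      = ((1 / ((N : ℝ) * R)) • ∑ n, ∑ m, vecMulVec (a n m) (a n m)) ⊗ₖ
          (∑ n, ∑ m, ∑ r, b n r m * Λ n r * (b n r m)ᵀ) := by
  have hsum : ∀ n r, ∑ m, vecKron (a n m) (b n r m) = vecKron (a n r) (b n r r) := fun n r =>
    Finset.sum_eq_single r (fun m _ hm => by rw [hb n r m hm.symm, vecKron_zero]) (by simp)
  have hdiag : ∀ n m, ∑ r, b n r m * Λ n r * (b n r m)ᵀ = C₀ := fun n m => by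
    rw [← hC n m]
    exact Finset.sum_eq_single m (fun r _ hr => by simp [hb n r m hr]) (by simp)
  have hN' : (N : ℝ) ≠ 0 := by positivity
  have hR' : (R : ℝ) ≠ 0 := by positivity
  simp only [hsum, hdiag, vecKron_mul_mul_transpose, hC]
  ext ⟨i, j⟩ ⟨k, l⟩
  simp only [Matrix.sum_apply, kroneckerMap_apply, Matrix.smul_apply, smul_eq_mul,
    Finset.sum_const, Finset.card_univ, Fintype.card_fin, ← Finset.sum_mul]
  rw [nsmul_eq_mul, nsmul_eq_mul]
  field_simp
end

section
/- Let N, R ≥ 1 be natural numbers, let x_{n,r} ∈ ℝ^D be vectors for n ∈ {1,…,N}, r ∈ {1,…,R}, and let S ∈ ℝ^{C×C} be a symmetric positive definite matrix. Then K-FAC-expand is exact for a single linear weight-sharing layer with Gaussian likelihood: Σ_{n=1}^N Σ_{r=1}^R (x_{n,r} ⊗ I_C) · S⁻¹ · (x_{n,r} ⊗ I_C)ᵀ = [ (1/(N·R)) Σ_{n=1}^N Σ_{r=1}^R x_{n,r} x_{n,r}ᵀ ] ⊗ [ (N·R) • S⁻¹ ]. -/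
open Matrix Kronecker

/-- The single-row GGN term factors as a Kronecker product. -/
theorem vecKron_one_mul_mul_transpose {p s : ℕ} (a : Fin p → ℝ) (M : Matrix (Fin s) (Fin s) ℝ) :
    vecKron a (1 : Matrix (Fin s) (Fin s) ℝ) * M *
        (vecKron a (1 : Matrix (Fin s) (Fin s) ℝ))ᵀ
      = vecMulVec a a ⊗ₖ M := by
  ext ⟨i, k⟩ ⟨j, l⟩
  simp [vecKron, Matrix.mul_apply, Matrix.one_apply, vecMulVec_apply]
  ring

/-- Exactness of K-FAC-expand for a single linear weight-sharing layer with a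
Gaussian likelihood in the expand setting. -/
theorem kfac_expand_exact_single_layer
    (N R D C : ℕ) (hN : 1 ≤ N) (hR : 1 ≤ R)
    (x : Fin N → Fin R → (Fin D → ℝ))
    (S : Matrix (Fin C) (Fin C) ℝ) (hS : S.PosDef) :
    ∑ n, ∑ r, vecKron (x n r) (1 : Matrix (Fin C) (Fin C) ℝ) * S⁻¹ *
        (vecKron (x n r) (1 : Matrix (Fin C) (Fin C) ℝ))ᵀ
      = ((1 / ((N : ℝ) * R)) • ∑ n, ∑ r, vecMulVec (x n r) (x n r)) ⊗ₖ
          (((N : ℝ) * R) • S⁻¹) := by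
  have hNR : (N : ℝ) * R ≠ 0 := by
    have : (N : ℝ) ≠ 0 := Nat.cast_ne_zero.mpr (by omega)
    have : (R : ℝ) ≠ 0 := Nat.cast_ne_zero.mpr (by omega)
    positivity
  simp_rw [vecKron_one_mul_mul_transpose]
  rw [smul_kronecker, kronecker_smul, smul_smul, one_div_mul_cancel hNR, one_smul]
  ext ⟨i, k⟩ ⟨j, l⟩
  simp [Matrix.sum_apply, Finset.sum_mul]
end

section
/- Let N, R ≥ 1 be natural numbers, let x_{n,r} ∈ ℝ^D be vectors for n ∈ {1,…,N}, r ∈ {1,…,R}, let W_a ∈ ℝ^{C×P_out} and W_b ∈ ℝ^{P_in×D} be matrices, and let S ∈ ℝ^{C×C} be symmetric positive definite. Then K-FAC-expand is exact for any layer ℓ of a deep linear network in the expand setting: Σ_{n=1}^N Σ_{r=1}^R ((W_b x_{n,r}) ⊗ W_aᵀ) · S⁻¹ · ((W_b x_{n,r}) ⊗ W_aᵀ)ᵀ = [ (1/(N·R)) Σ_{n=1}^N Σ_{r=1}^R (W_b x_{n,r})(W_b x_{n,r})ᵀ ] ⊗ [ (N·R) • (W_aᵀ · S⁻¹ · W_a)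 ]. -/
open Matrix Kronecker

/-- Exactness of K-FAC-expand for a layer of a deep linear network with a
Gaussian likelihood in the expand setting. `Wa` is the product of the weight
matrices ahead of the layer and `Wb` the product of those behind it. -/
theorem kfac_expand_exact_deep_linear
    (N R D C Pin Pout : ℕ) (hN : 1 ≤ N) (hR : 1 ≤ R)
    (x : Fin N → Fin R → (Fin D → ℝ))
    (Wa : Matrix (Fin C) (Fin Pout) ℝ)
    (Wb : Matrix (Fin Pin) (Fin D) ℝ)
    (S : Matrix (Fin C) (Fin C) ℝ) (hS : S.PosDef) :
    ∑ n, ∑ r, vecKron (Wb.mulVec (x n r)) Waᵀ * S⁻¹ *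
        (vecKron (Wb.mulVec (x n r)) Waᵀ)ᵀ
      = ((1 / ((N : ℝ) * R)) •
          ∑ n, ∑ r, vecMulVec (Wb.mulVec (x n r)) (Wb.mulVec (x n r))) ⊗ₖ
          (((N : ℝ) * R) • (Waᵀ * S⁻¹ * Wa)) := by
  have hNR : (N : ℝ) * R ≠ 0 := by positivity
  rw [smul_kronecker, kronecker_smul, smul_smul, one_div_mul_cancel hNR, one_smul]
  simp only [vecKron_mul_mul_transpose, transpose_transpose]
  ext ⟨i, j⟩ ⟨k, l⟩
  simp only [Matrix.sum_apply, kroneckerMap_apply, Finset.sum_mul]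
end

section
/- Let N, R ≥ 1 be natural numbers. For each n ∈ {1,…,N} and r ∈ {1,…,R}, let a_{n,r} ∈ ℝ^{P_in} be vectors and b_{n,r} ∈ ℝ^{P_out×C}, Λ_n ∈ ℝ^{C×C} matrices; let D_n ∈ ℝ^{P_out×C} (one per n) and C₀ ∈ ℝ^{P_out×P_out} be fixed matrices. Assume (i) b_{n,r} = D_n for all r ∈ {1,…,R}, and (ii) writing b̂_n := Σ_{r=1}^R b_{n,r}, it holds that b̂_n · Λ_n · b̂_nᵀ = C₀ for all n ∈ {1,…,N}. Then the exact layer-wise GGN equals the K-FAC-reduce approximation: Σ_{n=1}^N (Σ_{r=1}^R a_{n,r} ⊗ b_{n,r}) · Λ_n · (Σ_{r=1}^R a_{n,r} ⊗ b_{n,r})ᵀ = [ (1/(N·R²)) Σ_{n=1}^N (Σ_{r=1}^R a_{n,r})(Σ_{r=1}^R a_{n,r})ᵀ ] ⊗ [ Σ_{n=1}^N b̂_n · Λ_n · b̂_nᵀ ]. -/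
open Matrix Kronecker

theorem vecKron_sum_left {ι : Type*} (S : Finset ι) {p s t : ℕ} (a : ι → Fin p → ℝ)
    (B : Matrix (Fin s) (Fin t) ℝ) :
    vecKron (∑ i ∈ S, a i) B = ∑ i ∈ S, vecKron (a i) B := by
  ext q k
  simp [vecKron, Matrix.sum_apply, Finset.sum_mul]

theorem sum_kronecker {ι l m n p : Type*} (S : Finset ι) (A : ι → Matrix l m ℝ)
    (B : Matrix n p ℝ) : (∑ i ∈ S, A i) ⊗ₖ B = ∑ i ∈ S, A i ⊗ₖ B := by
  ext i j
  simp [Matrix.sum_apply, Finset.sum_mul]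

/-- Sufficient condition for exactness of K-FAC-reduce in the reduce setting. -/
theorem kfac_reduce_exact_of_b_const
    (N R Pin Pout C : ℕ) (hN : 1 ≤ N) (hR : 1 ≤ R)
    (a : Fin N → Fin R → (Fin Pin → ℝ))
    (b : Fin N → Fin R → Matrix (Fin Pout) (Fin C) ℝ)
    (Λ : Fin N → Matrix (Fin C) (Fin C) ℝ)
    (D : Fin N → Matrix (Fin Pout) (Fin C) ℝ)
    (C₀ : Matrix (Fin Pout) (Fin Pout) ℝ)
    (hb : ∀ n r, b n r = D n)
    (hC : ∀ n, (∑ r, b n r) * Λ n * (∑ r, b n r)ᵀ = C₀) :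
    ∑ n, (∑ r, vecKron (a n r) (b n r)) * Λ n * (∑ r, vecKron (a n r) (b n r))ᵀ
      = ((1 / ((N : ℝ) * R ^ 2)) •
          ∑ n, vecMulVec (∑ r, a n r) (∑ r, a n r)) ⊗ₖ
          (∑ n, (∑ r, b n r) * Λ n * (∑ r, b n r)ᵀ) := by
  have hN' : (N : ℝ) ≠ 0 := by positivity
  have hR' : (R : ℝ) ≠ 0 := by positivity
  have hD (n : Fin N) : D n * Λ n * (D n)ᵀ = ((R : ℝ) ^ 2)⁻¹ • C₀ := by
    have hsum : ∑ r, b n r = (R : ℝ) • D n := by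
      simp [hb, Nat.cast_smul_eq_nsmul]
    rw [← hC n, hsum, transpose_smul, smul_mul, smul_mul, Matrix.mul_smul, smul_smul, smul_smul,
      mul_assoc, ← sq, inv_mul_cancel₀ (pow_ne_zero 2 hR'), one_smul]
  have hB : ∑ n, (∑ r, b n r) * Λ n * (∑ r, b n r)ᵀ = (N : ℝ) • C₀ := by
    simp [hC, Nat.cast_smul_eq_nsmul]
  have hscalar : 1 / ((N : ℝ) * R ^ 2) * N = ((R : ℝ) ^ 2)⁻¹ := by
    field_simp
  rw [hB, smul_kronecker, kronecker_smul, smul_smul, hscalar, sum_kronecker, Finset.smul_sum]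
  refine Finset.sum_congr rfl fun n _ => ?_
  simp only [hb]
  rw [← vecKron_sum_left, vecKron_mul_mul_transpose, hD, kronecker_smul]
end

section
/- Let N, R ≥ 1 be natural numbers. For each n ∈ {1,…,N} and r ∈ {1,…,R}, let a_{n,r} ∈ ℝ^{P_in} be vectors, b_{n,r} ∈ ℝ^{P_out×C} and Λ_n ∈ ℝ^{C×C} matrices, and let D_n ∈ ℝ^{P_out×C} be fixed matrices (one per n). If b_{n,r} = D_n for all r ∈ {1,…,R}, then approximating each per-example Jacobian by a Kronecker product of sums is exact: Σ_{n=1}^N [ ((1/R) Σ_{r=1}^R a_{n,r}) ⊗ (Σ_{r=1}^R b_{n,r}) ] · Λ_n · [ ((1/R) Σ_{r=1}^R a_{n,r}) ⊗ (Σ_{r=1}^R b_{n,r}) ]ᵀ = Σ_{n=1}^N (Σ_{r=1}^R a_{n,r} ⊗ b_{n,r}) · Λ_n · (Σ_{r=1}^R a_{n,r} ⊗ b_{n,r})ᵀ. -/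
open Matrix Kronecker

/-- Averaging the vectors and summing copies of a fixed matrix recovers the sum of the
individual Kronecker products. -/
theorem vecKron_average_sum_const {R p s t : ℕ} (hR : 1 ≤ R) (a : Fin R → (Fin p → ℝ))
    (D : Matrix (Fin s) (Fin t) ℝ) :
    vecKron ((1 / (R : ℝ)) • ∑ r, a r) (∑ _r : Fin R, D) = ∑ r, vecKron (a r) D := by
  have hR0 : (R : ℝ) ≠ 0 := by exact_mod_cast Nat.one_le_iff_ne_zero.mp hR
  ext q k
  simp only [vecKron, Matrix.of_apply, Matrix.sum_apply, Pi.smul_apply, Finset.sum_apply,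
    smul_eq_mul, Finset.sum_const, Finset.card_univ, Fintype.card_fin, nsmul_eq_mul,
    ← Finset.sum_mul]
  field_simp

/-- If the per-row transposed output Jacobians `b n r` are the same for all
`r`, then approximating each per-example Jacobian by a Kronecker product of
sums (the first step in the K-FAC-reduce derivation) is exact. -/
theorem kfac_reduce_jacobian_approx_exact_of_b_const
    (N R Pin Pout C : ℕ) (hN : 1 ≤ N) (hR : 1 ≤ R)
    (a : Fin N → Fin R → (Fin Pin → ℝ))
    (b : Fin N → Fin R → Matrix (Fin Pout) (Fin C) ℝ)
    (Λ : Fin N → Matrix (Fin C) (Fin C) ℝ)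
    (D : Fin N → Matrix (Fin Pout) (Fin C) ℝ)
    (hb : ∀ n r, b n r = D n) :
    ∑ n, vecKron ((1 / (R : ℝ)) • ∑ r, a n r) (∑ r, b n r) * Λ n *
        (vecKron ((1 / (R : ℝ)) • ∑ r, a n r) (∑ r, b n r))ᵀ
      = ∑ n, (∑ r, vecKron (a n r) (b n r)) * Λ n *
          (∑ r, vecKron (a n r) (b n r))ᵀ := by
  simp only [hb, vecKron_average_sum_const hR]
end

section
/- Let N, R ≥ 1 be natural numbers, let x_{n,r} ∈ ℝ^D be vectors for n ∈ {1,…,N}, r ∈ {1,…,R}, let c ∈ ℝ, and let S ∈ ℝ^{C×C} be symmetric positive definite. Then K-FAC-reduce is exact for a single linear weight-sharing layer followed by scaled-sum aggregation, with Gaussian likelihood: Σ_{n=1}^N ( (Σ_{r=1}^R x_{n,r}) ⊗ (c • I_C) ) · S⁻¹ · ( (Σ_{r=1}^R x_{n,r}) ⊗ (c • I_C) )ᵀ = [ (1/(N·R²)) Σ_{n=1}^N (Σ_{r=1}^R x_{n,r})(Σ_{r=1}^R x_{n,r})ᵀ ] ⊗ [ (N·c²·R²) • S⁻¹ ]. 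-/
open Matrix Kronecker

/-- Conjugating `M` by the Kronecker product of a vector with a scalar matrix gives
`(a aᵀ) ⊗ (c² M)`. -/
theorem vecKron_smul_one_mul_mul_transpose {p s : ℕ} (a : Fin p → ℝ) (c : ℝ)
    (M : Matrix (Fin s) (Fin s) ℝ) :
    vecKron a (c • (1 : Matrix (Fin s) (Fin s) ℝ)) * M *
        (vecKron a (c • (1 : Matrix (Fin s) (Fin s) ℝ)))ᵀ
      = vecMulVec a a ⊗ₖ (c ^ 2 • M) := by
  ext ⟨i, k⟩ ⟨j, l⟩
  simp [vecKron, Matrix.mul_apply, Matrix.one_apply, vecMulVec_apply]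
  ring

/-- Exactness of K-FAC-reduce for a single linear weight-sharing layer followed
by a scaled-sum aggregation, with a Gaussian likelihood, in the reduce
setting. -/
theorem kfac_reduce_exact_single_layer
    (N R D C : ℕ) (hN : 1 ≤ N) (hR : 1 ≤ R)
    (x : Fin N → Fin R → (Fin D → ℝ)) (c : ℝ)
    (S : Matrix (Fin C) (Fin C) ℝ) (hS : S.PosDef) :
    ∑ n, vecKron (∑ r, x n r) (c • (1 : Matrix (Fin C) (Fin C) ℝ)) * S⁻¹ *
        (vecKron (∑ r, x n r) (c • (1 : Matrix (Fin C) (Fin C) ℝ)))ᵀ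
      = ((1 / ((N : ℝ) * R ^ 2)) •
          ∑ n, vecMulVec (∑ r, x n r) (∑ r, x n r)) ⊗ₖ
          (((N : ℝ) * c ^ 2 * R ^ 2) • S⁻¹) := by
  have hN' : (N : ℝ) ≠ 0 := Nat.cast_ne_zero.mpr (by lia)
  have hR' : (R : ℝ) ≠ 0 := Nat.cast_ne_zero.mpr (by lia)
  simp_rw [vecKron_smul_one_mul_mul_transpose]
  ext ⟨i, k⟩ ⟨j, l⟩
  simp only [Matrix.sum_apply, kronecker_apply, Matrix.smul_apply, smul_eq_mul,
    ← Finset.sum_mul]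
  field_simp
end

section
/- Let N, R ≥ 1 be natural numbers, let x_{n,r} ∈ ℝ^D be vectors for n ∈ {1,…,N}, r ∈ {1,…,R}, let W_a ∈ ℝ^{C×P_out} and W_b ∈ ℝ^{P_in×D} be matrices, let c ∈ ℝ, and let S ∈ ℝ^{C×C} be symmetric positive definite. Then K-FAC-reduce is exact for any layer ℓ of a deep linear network with scaled-sum aggregation in the reduce setting: Σ_{n=1}^N ( (W_b Σ_{r=1}^R x_{n,r}) ⊗ (c • W_aᵀ) ) · S⁻¹ · ( (W_b Σ_{r=1}^R x_{n,r}) ⊗ (c • W_aᵀ) )ᵀ = [ (1/(N·R²)) Σ_{n=1}^N (W_b Σ_{r=1}^R x_{n,r})(W_b Σ_{r=1}^R x_{n,r})ᵀ ] ⊗ [ (N·c²·R²) • (W_aᵀ · S⁻¹ · W_a) ]. -/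
open Matrix Kronecker

/-- Exactness of K-FAC-reduce for a layer of a deep linear network with
scaled-sum aggregation and a Gaussian likelihood in the reduce setting.
`Wa` is the product of the weight matrices ahead of the layer and `Wb` the
product of those behind it. -/
theorem kfac_reduce_exact_deep_linear
    (N R D C Pin Pout : ℕ) (hN : 1 ≤ N) (hR : 1 ≤ R)
    (x : Fin N → Fin R → (Fin D → ℝ))
    (Wa : Matrix (Fin C) (Fin Pout) ℝ)
    (Wb : Matrix (Fin Pin) (Fin D) ℝ) (c : ℝ)
    (S : Matrix (Fin C) (Fin C) ℝ) (hS : S.PosDef) :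
    ∑ n, vecKron (Wb.mulVec (∑ r, x n r)) (c • Waᵀ) * S⁻¹ *
        (vecKron (Wb.mulVec (∑ r, x n r)) (c • Waᵀ))ᵀ
      = ((1 / ((N : ℝ) * R ^ 2)) •
          ∑ n, vecMulVec (Wb.mulVec (∑ r, x n r)) (Wb.mulVec (∑ r, x n r))) ⊗ₖ
          (((N : ℝ) * c ^ 2 * R ^ 2) • (Waᵀ * S⁻¹ * Wa)) := by
  have hN' : (N : ℝ) ≠ 0 := by positivity
  have hR' : (R : ℝ) ≠ 0 := by positivity
  simp only [vecKron_mul_mul_transpose]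
  ext i j
  simp only [Matrix.sum_apply, kroneckerMap_apply, Matrix.smul_apply, smul_mul, Matrix.mul_smul,
    transpose_smul, transpose_transpose, smul_eq_mul, ← Finset.sum_mul]
  field_simp
end
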